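/- arXiv:1610.09745 — 9 statements merged into one kernel-verified Lean document; each statement's English description precedes it below -/
import Mathlib

section
/- Let n ≥ 2 and M ≥ 1 be integers and let h : V → ℝ be the hitting-time solution for the target vertex b = (2,…,2). Then h((1,…,1)) = ((n−1)M/n) · ∑_{k=1}^{M} n^k/k. -/
open Finset

/-- `h` is the hitting-time solution for target `b` of the symmetric nearest-neighbor
random walk on the Hamming graph `{1,…,n}^M` (vertices differ in exactly one coordinate). -/
def IsHitSol {M n : ℕ} (b : Fin M → Fin n) (h : (Fin M → Fin n) → ℝ) : Prop :=
  h b = 0 ∧ ∀ x, x ≠ b →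
    h x = 1 + (1 / (((n : ℝ) - 1) * M)) *
      ∑ y ∈ univ.filter (fun y => hammingDist x y = 1), h y

section HammingGraph

variable {ι α : Type*} [Fintype ι] [DecidableEq ι] [DecidableEq α]

theorem hammingDist_update_add (x b : ι → α) (i : ι) (c : α) :
    hammingDist (Function.update x i c) b + (if x i ≠ b i then 1 else 0) =
      hammingDist x b + (if c ≠ b i then 1 else 0) := by
  simp only [hammingDist, card_filter]
  rw [← add_sum_erase univ _ (mem_univ i), ← add_sum_erase univ _ (mem_univ i)]
  have : ∑ j ∈ univ.erase i, (if Function.update x i c j ≠ b j then 1 else 0) =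
      ∑ j ∈ univ.erase i, (if x j ≠ b j then 1 else 0) := by
    refine sum_congr rfl fun j hj => ?_
    rw [Function.update_of_ne (ne_of_mem_erase hj)]
  rw [this, Function.update_self]
  ring

theorem hammingDist_self_update {x : ι → α} {i : ι} {c : α} (hc : c ≠ x i) :
    hammingDist x (Function.update x i c) = 1 := by
  have := hammingDist_update_add x x i c
  simpa [hc, hammingDist_comm] using this

theorem sum_hammingDist_eq_one [Fintype α] (x : ι → α) (F : (ι → α) → ℝ) :
    ∑ y ∈ univ.filter (fun y => hammingDist x y = 1), F y =
      ∑ i, ∑ c ∈ univ.erase (x i), F (Function.update x i c) := by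
  rw [sum_sigma']
  symm
  refine sum_bij (fun p _ => Function.update x p.1 p.2) ?_ ?_ ?_ ?_
  · rintro ⟨i, c⟩ h
    simp only [mem_sigma, mem_erase, mem_univ, true_and, and_true] at h
    simpa using hammingDist_self_update h
  · rintro ⟨i, c⟩ h ⟨j, d⟩ h' e
    simp only [mem_sigma, mem_erase, mem_univ, true_and, and_true] at h h' e
    have hij : i = j := by
      by_contra hij
      have := congrFun e i
      rw [Function.update_self, Function.update_of_ne hij] at this
      exact h this
    subst hij
    have := congrFun e i
    simp only [Function.update_self] at this
    rw [this]
  · intro y hy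
    simp only [mem_filter, mem_univ, true_and, hammingDist] at hy
    obtain ⟨i, hi⟩ := card_eq_one.1 hy
    have key : ∀ j, x j ≠ y j ↔ j = i := fun j => by
      simpa using congrArg (j ∈ ·) hi
    refine ⟨⟨i, y i⟩, ?_, ?_⟩
    · simpa using ((key i).2 rfl).symm
    · funext j
      by_cases hj : j = i
      · subst hj; simp
      · rw [Function.update_of_ne hj]
        by_contra hne
        exact hj ((key j).1 hne)
  · intros; rfl

theorem card_hammingDist_eq_one [Fintype α] (x : ι → α) (hα : 1 ≤ Fintype.card α) :
    ((#(univ.filter (fun y => hammingDist x y = 1)) : ℕ) : ℝ) =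
      ((Fintype.card α : ℝ) - 1) * Fintype.card ι := by
  have := sum_hammingDist_eq_one x (fun _ => (1 : ℝ))
  simp only [sum_const, card_erase_of_mem (mem_univ _), card_univ, nsmul_eq_mul, mul_one] at this
  rw [this, Nat.cast_sub hα]
  push_cast
  ring

/-- The sum over the Hamming neighbours of `x` of a function of the distance to `b`. -/
theorem sum_radial [Fintype α] (x b : ι → α) (H : ℕ → ℝ) (hα : 2 ≤ Fintype.card α) :
    ∑ y ∈ univ.filter (fun y => hammingDist x y = 1), H (hammingDist y b) =
      hammingDist x b * (H (hammingDist x b - 1) +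
        ((Fintype.card α : ℝ) - 2) * H (hammingDist x b)) +
      ((Fintype.card ι : ℝ) - hammingDist x b) *
        (((Fintype.card α : ℝ) - 1) * H (hammingDist x b + 1)) := by
  rw [sum_hammingDist_eq_one]
  set d := hammingDist x b with hd
  have inner : ∀ i, ∑ c ∈ univ.erase (x i), H (hammingDist (Function.update x i c) b) =
      if x i ≠ b i then H (d - 1) + ((Fintype.card α : ℝ) - 2) * H d
      else ((Fintype.card α : ℝ) - 1) * H (d + 1) := by
    intro i
    split_ifs with hi
    · rw [← add_sum_erase _ _ (mem_erase.2 ⟨hi.symm, mem_univ (b i)⟩)]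
      congr 1
      · have := hammingDist_update_add x b i (b i)
        simp only [hi, ne_eq, not_false_eq_true, if_true, not_true_eq_false, if_false] at this
        congr 1
        omega
      · rw [sum_congr rfl (g := fun _ => H d), sum_const,
          card_erase_of_mem (mem_erase.2 ⟨hi.symm, mem_univ (b i)⟩),
          card_erase_of_mem (mem_univ _), card_univ, nsmul_eq_mul, Nat.sub_sub, Nat.cast_sub hα]
        · norm_num
        · intro c hc
          have := hammingDist_update_add x b i c
          simp only [hi, ne_of_mem_erase hc, ne_eq, not_false_eq_true, if_true] at this
          congr 1
          omega
    · rw [sum_congr rfl (g := fun _ => H (d + 1)), sum_const,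
          card_erase_of_mem (mem_univ _), card_univ, nsmul_eq_mul, Nat.cast_sub (by omega)]
      · norm_num
      · intro c hc
        have hb : x i = b i := not_not.1 hi
        have := hammingDist_update_add x b i c
        simp only [hi, hb ▸ ne_of_mem_erase hc, ne_eq, not_false_eq_true, if_true, if_false] at this
        congr 1
  simp only [inner]
  rw [sum_ite, sum_const, sum_const, nsmul_eq_mul, nsmul_eq_mul]
  have hc := card_filter_add_card_filter_not (s := (univ : Finset ι)) (fun i => x i ≠ b i)
  have h1 : #(univ.filter fun i => x i ≠ b i) = d := rfl
  rw [h1, card_univ] at hc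
  rw [h1, ← hc]
  push_cast
  ring

/-- Maximum principle for functions subharmonic away from `b`. -/
theorem le_of_subharmonic [Fintype α] (b : ι → α) (g : (ι → α) → ℝ)
    (hg : ∀ x, x ≠ b → #(univ.filter (fun y => hammingDist x y = 1)) * g x ≤
      ∑ y ∈ univ.filter (fun y => hammingDist x y = 1), g y) (x : ι → α) : g x ≤ g b := by
  obtain ⟨m, -, hm⟩ := exists_max_image univ g ⟨b, mem_univ b⟩
  have hm' : ∀ y, g y ≤ g m := fun y => hm y (mem_univ y)
  have key : ∀ d, ∀ y, hammingDist y b = d → g y = g m → g b = g m := by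
    intro d
    induction d with
    | zero => intro y hy h; rwa [← hammingDist_eq_zero.1 hy]
    | succ d ih =>
      intro y hy h
      have hne : y ≠ b := fun e => by simp [e] at hy
      obtain ⟨i, hi⟩ := Function.ne_iff.1 hne
      refine ih (Function.update y i (b i)) ?_ ?_
      · have := hammingDist_update_add y b i (b i)
        simp only [hi, ne_eq, not_false_eq_true, if_true, not_true_eq_false, if_false] at this
        omega
      · by_contra hlt
        have := sum_lt_sum (s := univ.filter (fun z => hammingDist y z = 1)) (f := g)
          (g := fun _ => g m) (fun z _ => hm' z)
          ⟨Function.update y i (b i), by simpa using hammingDist_self_update (Ne.symm hi),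
            lt_of_le_of_ne (hm' _) hlt⟩
        rw [sum_const, nsmul_eq_mul, ← h] at this
        exact absurd (hg y hne) (not_le.2 this)
  rw [key _ m rfl rfl]
  exact hm' x

end HammingGraph

theorem IsHitSol.unique {M n : ℕ} (hn : 2 ≤ n) (hM : 1 ≤ M) {b : Fin M → Fin n}
    {f g : (Fin M → Fin n) → ℝ} (hf : IsHitSol b f) (hg : IsHitSol b g) : f = g := by
  have hN : ((n : ℝ) - 1) * M ≠ 0 := by
    have : (2 : ℝ) ≤ n := by exact_mod_cast hn
    have : (1 : ℝ) ≤ M := by exact_mod_cast hM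
    apply mul_ne_zero <;> linarith
  have main : ∀ f g : (Fin M → Fin n) → ℝ, IsHitSol b f → IsHitSol b g → ∀ x, f x ≤ g x := by
    intro f g hf hg x
    have := le_of_subharmonic b (fun x => f x - g x) (fun x hx => le_of_eq ?_) x
    · simp only [hf.1, hg.1] at this
      linarith
    · rw [card_hammingDist_eq_one x (by simp; omega), sum_sub_distrib, hf.2 x hx, hg.2 x hx]
      simp only [Fintype.card_fin]
      linear_combination (∑ y ∈ univ.filter (fun y => hammingDist x y = 1), f y -
        ∑ y ∈ univ.filter (fun y => hammingDist x y = 1), g y) * mul_one_div_cancel hN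
  funext x
  exact le_antisymm (main f g hf hg x) (main g f hg hf x)

/-- The integral `∫₀¹ t ^ (d - 1) (n - (n - 1) t) ^ j dt`, with `d` shifted by one. -/
noncomputable def stepIntegral (n : ℝ) (d j : ℕ) : ℝ :=
  ∫ t in (0 : ℝ)..1, t ^ d * (n - (n - 1) * t) ^ j

theorem hasDerivAt_affine_pow (n : ℝ) (j : ℕ) (t : ℝ) :
    HasDerivAt (fun t : ℝ => (n - (n - 1) * t) ^ (j + 1))
      (-((j + 1) * (n - 1) * (n - (n - 1) * t) ^ j)) t := by
  have h := (((hasDerivAt_id t).const_mul (n - 1)).const_sub n).pow (j + 1)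
  refine h.congr_deriv ?_
  simp only [id, Nat.add_sub_cancel, Nat.cast_add, Nat.cast_one]
  ring

theorem stepIntegral_zero_right (n : ℝ) (d : ℕ) : (d + 1) * stepIntegral n d 0 = 1 := by
  simp [stepIntegral, integral_pow]
  field_simp

theorem stepIntegral_zero_left (n : ℝ) (j : ℕ) :
    (j + 1) * ((n - 1) * stepIntegral n 0 j) = n ^ (j + 1) - 1 := by
  have := intervalIntegral.integral_eq_sub_of_hasDerivAt (a := 0) (b := 1)
    (fun t _ => hasDerivAt_affine_pow n j t)
    (Continuous.intervalIntegrable (by fun_prop) _ _)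
  rw [intervalIntegral.integral_neg, intervalIntegral.integral_const_mul] at this
  simp only [stepIntegral, pow_zero, one_mul]
  simp at this
  linarith

theorem stepIntegral_succ_right (n : ℝ) (d j : ℕ) :
    (d + 1) * stepIntegral n d (j + 1) =
      1 + (j + 1) * (n - 1) * stepIntegral n (d + 1) j := by
  have := intervalIntegral.integral_eq_sub_of_hasDerivAt (a := 0) (b := 1)
    (fun t _ => (hasDerivAt_pow (d + 1) t).mul (hasDerivAt_affine_pow n j t))
    (Continuous.intervalIntegrable (by fun_prop) _ _)
  rw [intervalIntegral.integral_add (Continuous.intervalIntegrable (by fun_prop) _ _)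
    (Continuous.intervalIntegrable (by fun_prop) _ _)] at this
  have e1 : (d + 1) * stepIntegral n d (j + 1) = ∫ t in (0 : ℝ)..1,
      (((d + 1 : ℕ) : ℝ) * t ^ (d + 1 - 1)) * (n - (n - 1) * t) ^ (j + 1) := by
    rw [stepIntegral, ← intervalIntegral.integral_const_mul]
    congr 1
    funext t
    rw [Nat.add_sub_cancel]
    push_cast
    ring
  have e2 : -((j + 1) * (n - 1) * stepIntegral n (d + 1) j) = ∫ t in (0 : ℝ)..1,
      t ^ (d + 1) * -((j + 1) * (n - 1) * (n - (n - 1) * t) ^ j) := by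
    rw [stepIntegral, ← intervalIntegral.integral_const_mul, ← intervalIntegral.integral_neg]
    congr 1
    funext t
    ring
  rw [← e1, ← e2] at this
  simp at this
  linarith

theorem geom_sum_succ_sub (n t : ℝ) (M : ℕ) :
    n * (∑ i ∈ range (M + 1), t ^ i * (n - (n - 1) * t) ^ (M - i) -
      ∑ i ∈ range M, t ^ i * (n - (n - 1) * t) ^ (M - 1 - i)) =
      (n - 1) * (n - (n - 1) * t) ^ M + t ^ M := by
  have h := (Commute.all t (n - (n - 1) * t)).geom_sum₂_mul M
  have e : ∑ i ∈ range (M + 1), t ^ i * (n - (n - 1) * t) ^ (M - i) =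
      (n - (n - 1) * t) * ∑ i ∈ range M, t ^ i * (n - (n - 1) * t) ^ (M - 1 - i) + t ^ M := by
    rw [sum_range_succ, mul_sum]
    congr 1
    · refine sum_congr rfl fun i hi => ?_
      have : M - i = M - 1 - i + 1 := by have := mem_range.1 hi; omega
      rw [this]
      ring
    · simp
  rw [e]
  linear_combination (-(n - 1)) * h

theorem sum_stepIntegral (n : ℝ) (hn : n ≠ 0) (M : ℕ) :
    ∑ i ∈ range M, stepIntegral n i (M - 1 - i) = (∑ k ∈ Icc 1 M, n ^ k / k) / n := by
  have hint : ∀ M : ℕ, ∑ i ∈ range M, stepIntegral n i (M - 1 - i) =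
      ∫ t in (0 : ℝ)..1, ∑ i ∈ range M, t ^ i * (n - (n - 1) * t) ^ (M - 1 - i) := by
    intro M
    rw [intervalIntegral.integral_finsetSum]
    · rfl
    · exact fun i _ => Continuous.intervalIntegrable (by fun_prop) _ _
  induction M with
  | zero => simp
  | succ M ih =>
    rw [sum_Icc_succ_top (by omega), add_div, ← ih]
    have hdiff : n * (∑ i ∈ range (M + 1), stepIntegral n i (M + 1 - 1 - i) -
        ∑ i ∈ range M, stepIntegral n i (M - 1 - i)) =
        (n - 1) * stepIntegral n 0 M + stepIntegral n M 0 := by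
      rw [hint, hint, ← intervalIntegral.integral_sub
        (Continuous.intervalIntegrable (by fun_prop) _ _)
        (Continuous.intervalIntegrable (by fun_prop) _ _),
        ← intervalIntegral.integral_const_mul, stepIntegral, stepIntegral,
        ← intervalIntegral.integral_const_mul, ← intervalIntegral.integral_add
        (Continuous.intervalIntegrable (by fun_prop) _ _)
        (Continuous.intervalIntegrable (by fun_prop) _ _)]
      congr 1
      funext t
      simpa using geom_sum_succ_sub n t M
    have h0 := stepIntegral_zero_left n M
    have h1 := stepIntegral_zero_right n M
    have hM : (M : ℝ) + 1 ≠ 0 := by positivity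
    rw [Nat.add_sub_cancel] at hdiff ⊢
    push_cast
    field_simp
    linear_combination ((M : ℝ) + 1) * hdiff + h0 + h1

/-- The expected hitting time as a function of the Hamming distance to the target. -/
noncomputable def radialHit (n M d : ℕ) : ℝ :=
  ((n : ℝ) - 1) * M * ∑ i ∈ range d, stepIntegral n i (M - 1 - i)

theorem isHitSol_radialHit {M n : ℕ} (hn : 2 ≤ n) (hM : 1 ≤ M) (b : Fin M → Fin n) :
    IsHitSol b (fun x => radialHit n M (hammingDist x b)) := by
  have hN : ((n : ℝ) - 1) * M ≠ 0 := by
    have : (2 : ℝ) ≤ n := by exact_mod_cast hn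
    have : (1 : ℝ) ≤ M := by exact_mod_cast hM
    apply mul_ne_zero <;> linarith
  refine ⟨by simp [radialHit], fun x hx => ?_⟩
  rw [sum_radial x b (radialHit n M) (by simpa using hn)]
  have hle : hammingDist x b ≤ M := by simpa using hammingDist_le_card_fintype (x := x) (y := b)
  obtain ⟨d, hd⟩ := Nat.exists_eq_succ_of_ne_zero (hammingDist_ne_zero.2 hx)
  simp only [hd, Fintype.card_fin, Nat.succ_eq_add_one, Nat.add_sub_cancel] at hle ⊢
  obtain ⟨j, rfl⟩ := Nat.exists_eq_add_of_le hle
  have step : ((d : ℝ) + 1) * stepIntegral n d j =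
      1 + j * (n - 1) * stepIntegral n (d + 1) (j - 1) := by
    cases j with
    | zero => simpa using stepIntegral_zero_right n d
    | succ j => simpa using stepIntegral_succ_right n d j
  have e1 : d + 1 + j - 1 - d = j := by omega
  have e2 : d + 1 + j - 1 - (d + 1) = j - 1 := by omega
  simp only [radialHit, sum_range_succ, e1, e2]
  have hN' := hN
  push_cast at hN' ⊢
  generalize stepIntegral n d j = A at *
  generalize stepIntegral n (d + 1) (j - 1) = B at *
  generalize ∑ i ∈ range d, stepIntegral n i (d + 1 + j - 1 - i) = S at *
  rw [← sub_eq_zero]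
  have hn1 : (n : ℝ) - 1 ≠ 0 := left_ne_zero_of_mul hN'
  have hM1 : (d : ℝ) + 1 + j ≠ 0 := right_ne_zero_of_mul hN'
  field_simp
  linear_combination step

theorem stmt_0 (n M : ℕ) (hn : 2 ≤ n) (hM : 1 ≤ M)
    (h : (Fin M → Fin n) → ℝ)
    (hsol : IsHitSol (fun _ => (⟨1, by omega⟩ : Fin n)) h) :
    h (fun _ => (⟨0, by omega⟩ : Fin n)) =
      (((n : ℝ) - 1) * M / n) * ∑ k ∈ Finset.Icc 1 M, (n : ℝ) ^ k / k := by
  have hn0 : (n : ℝ) ≠ 0 := by positivity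
  rw [hsol.unique hn hM (isHitSol_radialHit hn hM _)]
  have hd : hammingDist (fun _ : Fin M => (⟨0, by omega⟩ : Fin n))
      (fun _ => (⟨1, by omega⟩ : Fin n)) = M := by
    simp [hammingDist]
  simp only [hd, radialHit, sum_stepIntegral (n : ℝ) hn0]
  ring
end

section
/- Let n ≥ 2 and M ≥ 1 be integers and let e : {0,1,…,M−1} → ℝ satisfy e(0) = n−1 and, for every 1 ≤ k ≤ M−1, e(k) = ((n−1)k/(M−k))·e(k−1) + (n−1)M/(M−k). Then for every 0 ≤ k ≤ M−1, e(k) = ((n−1)^{k+1}/C(M−1,k)) · ∑_{ℓ=0}^{k} C(M,ℓ)/(n−1)^{ℓ}, where C(n,m) denotes the binomial coefficient. -/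
theorem stmt_4 (n M : ℕ) (hn : 2 ≤ n) (hM : 1 ≤ M)
    (e : ℕ → ℝ) (he0 : e 0 = (n : ℝ) - 1)
    (herec : ∀ k, 1 ≤ k → k ≤ M - 1 →
      e k = (((n : ℝ) - 1) * k / ((M : ℝ) - k)) * e (k - 1) +
        ((n : ℝ) - 1) * M / ((M : ℝ) - k)) :
    ∀ k, k ≤ M - 1 →
      e k = (((n : ℝ) - 1) ^ (k + 1) / ((M - 1).choose k : ℝ)) *
        ∑ ℓ ∈ Finset.range (k + 1), (M.choose ℓ : ℝ) / ((n : ℝ) - 1) ^ ℓ := by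
  obtain ⟨m, rfl⟩ : ∃ m, M = m + 1 := ⟨M - 1, by omega⟩
  simp only [Nat.add_sub_cancel] at herec ⊢
  have hn' : (2 : ℝ) ≤ n := by exact_mod_cast hn
  have ha : (n : ℝ) - 1 ≠ 0 := by linarith
  generalize (n : ℝ) - 1 = a at *
  intro k
  induction k with
  | zero => intro _; simp [he0]
  | succ k ih =>
    intro hk
    have hmk : (m : ℝ) - k ≠ 0 := by
      have : (k : ℝ) + 1 ≤ m := by exact_mod_cast hk
      linarith
    have hk1 : (k : ℝ) + 1 ≠ 0 := by positivity
    have hc : (m.choose k : ℝ) ≠ 0 := by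
      exact_mod_cast (Nat.choose_pos (by omega : k ≤ m)).ne'
    have hd : (m.choose (k + 1) : ℝ) = m.choose k * (m - k) / (k + 1) := by
      rw [eq_div_iff hk1, ← Nat.cast_sub (by omega : k ≤ m)]
      exact_mod_cast Nat.choose_succ_right_eq m k
    have hb : ((m + 1).choose (k + 1) : ℝ) = (m + 1) * m.choose k / (k + 1) := by
      rw [eq_div_iff hk1]
      exact_mod_cast (Nat.add_one_mul_choose_eq m k).symm
    rw [herec (k + 1) (by omega) hk, Nat.add_sub_cancel, ih (by omega),
      Finset.sum_range_succ _ (k + 1), hd, hb]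
    push_cast
    rw [add_sub_add_right_eq_sub]
    field_simp
    ring
end

section
/- Let n ≥ 2 and M ≥ 1 be integers. If g : {0,1,…,M} → ℝ is the birth–death hitting-time solution, then g(0) = ((n−1)M/n) · ∑_{k=1}^{M} n^k/k. -/
/-- `g` is the birth–death hitting-time solution for the chain on `{0,…,M}` with
transition probabilities `p_{j,j-1} = j/M`, `p_{j,j} = (n-2)(M-j)/((n-1)M)`,
`p_{j,j+1} = (M-j)/((n-1)M)`, target state `M`.  (When `j = 0` the coefficient
`j/M` vanishes, so the `g (j-1)` term is absent.) -/
def IsBDSol (n M : ℕ) (g : ℕ → ℝ) : Prop :=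
  g M = 0 ∧ ∀ j < M,
    g j = 1 + ((j : ℝ) / M) * g (j - 1) +
      (((n : ℝ) - 2) * ((M : ℝ) - j) / (((n : ℝ) - 1) * M)) * g j +
      (((M : ℝ) - j) / (((n : ℝ) - 1) * M)) * g (j + 1)

/-- The reciprocal binomial weight `1 / ((m + 1) * m.choose j)`, i.e. `B(j + 1, m - j + 1)`. -/
noncomputable def betaWeight (m j : ℕ) : ℝ := 1 / (((m : ℝ) + 1) * (m.choose j : ℝ))

/-- The partial sum `∑_{i ≤ j} (m.choose i) * c ^ (j - i)`, defined recursively in `j`. -/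
noncomputable def binomPartial (c : ℝ) (m : ℕ) : ℕ → ℝ
  | 0 => 1
  | j + 1 => (m.choose (j + 1) : ℝ) + c * binomPartial c m j

theorem binomPartial_succ_succ (c : ℝ) (m j : ℕ) :
    binomPartial c (m + 1) (j + 1) = binomPartial c m (j + 1) + binomPartial c m j := by
  induction j with
  | zero => simp [binomPartial]; ring
  | succ j ih =>
    rw [binomPartial, ih, binomPartial.eq_2 c m (j + 1), Nat.choose_succ_succ' m (j + 1)]
    conv_rhs => rw [binomPartial.eq_2 c m j]
    conv_lhs => rw [binomPartial.eq_2 c m j]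
    push_cast
    ring

theorem binomPartial_self (c : ℝ) (m : ℕ) : binomPartial c m m = (1 + c) ^ m := by
  induction m with
  | zero => simp [binomPartial]
  | succ m ih =>
    rw [binomPartial_succ_succ, binomPartial, ih]
    simp
    ring

theorem betaWeight_eq_add {m j : ℕ} (h : j ≤ m) :
    betaWeight m j = betaWeight (m + 1) j + betaWeight (m + 1) (j + 1) := by
  have hx : (0 : ℝ) < m.choose j := by exact_mod_cast Nat.choose_pos h
  have hy : (0 : ℝ) < (m + 1).choose j := by exact_mod_cast Nat.choose_pos (by omega)
  have hz : (0 : ℝ) < (m + 1).choose (j + 1) := by exact_mod_cast Nat.choose_pos (by omega)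
  have h₁ : (m.choose j : ℝ) * (m + 1) = (m + 1).choose j * ((m : ℝ) + 1 - j) := by
    have := congrArg (Nat.cast (R := ℝ)) (Nat.choose_mul_succ_eq m j)
    push_cast [Nat.cast_sub (show j ≤ m + 1 by omega)] at this
    exact this
  have h₂ : ((m : ℝ) + 1) * m.choose j = (m + 1).choose (j + 1) * ((j : ℝ) + 1) := by
    exact_mod_cast Nat.add_one_mul_choose_eq m j
  have hy' : 1 / ((m + 1).choose j : ℝ) = ((m : ℝ) + 1 - j) / ((m + 1) * m.choose j) := by
    rw [div_eq_div_iff hy.ne' (by positivity)]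
    linarith
  have hz' : 1 / ((m + 1).choose (j + 1) : ℝ) = ((j : ℝ) + 1) / ((m + 1) * m.choose j) := by
    rw [div_eq_div_iff hz.ne' (by positivity)]
    linarith
  unfold betaWeight
  push_cast
  rw [← one_div_mul_one_div _ ((m + 1).choose j : ℝ),
    ← one_div_mul_one_div _ ((m + 1).choose (j + 1) : ℝ), hy', hz']
  field_simp
  ring

theorem sum_betaWeight_mul_binomPartial_succ (c : ℝ) (m : ℕ) :
    ∑ j ∈ Finset.range (m + 2), betaWeight (m + 1) j * binomPartial c (m + 2) j =
      ∑ j ∈ Finset.range (m + 1), betaWeight m j * binomPartial c (m + 1) j +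
        (1 + c) ^ (m + 1) / ((m : ℝ) + 2) := by
  have h : ∑ j ∈ Finset.range (m + 1), betaWeight m j * binomPartial c (m + 1) j =
      ∑ j ∈ Finset.range (m + 1), betaWeight (m + 1) j * binomPartial c (m + 1) j +
      ∑ j ∈ Finset.range (m + 1), betaWeight (m + 1) (j + 1) * binomPartial c (m + 1) j := by
    rw [← Finset.sum_add_distrib]
    refine Finset.sum_congr rfl fun j hj => ?_
    rw [betaWeight_eq_add (Nat.lt_succ_iff.mp (Finset.mem_range.mp hj)), add_mul]
  have hlast : betaWeight (m + 1) (m + 1) * binomPartial c (m + 1) (m + 1) =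
      (1 + c) ^ (m + 1) / ((m : ℝ) + 2) := by
    rw [binomPartial_self, betaWeight, Nat.choose_self]
    push_cast
    ring
  have hshift := Finset.sum_range_succ
    (fun j => betaWeight (m + 1) j * binomPartial c (m + 1) j) (m + 1)
  rw [Finset.sum_range_succ'] at hshift
  rw [Finset.sum_range_succ', h, ← hlast]
  simp only [binomPartial_succ_succ c (m + 1), mul_add, Finset.sum_add_distrib]
  simp only [binomPartial.eq_1] at hshift ⊢
  linarith

theorem sum_betaWeight_mul_binomPartial (c : ℝ) (m : ℕ) :
    (1 + c) * ∑ j ∈ Finset.range (m + 1), betaWeight m j * binomPartial c (m + 1) j =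
      ∑ k ∈ Finset.Icc 1 (m + 1), (1 + c) ^ k / (k : ℝ) := by
  induction m with
  | zero => simp [betaWeight, binomPartial]
  | succ m ih =>
    rw [sum_betaWeight_mul_binomPartial_succ, mul_add, ih,
      Finset.sum_Icc_succ_top (show 1 ≤ m + 1 + 1 by omega)]
    push_cast
    ring

theorem sub_mul_betaWeight_succ {m j : ℕ} (h : j < m) :
    ((m : ℝ) - j) * betaWeight m (j + 1) = ((j : ℝ) + 1) * betaWeight m j := by
  have hx : (0 : ℝ) < m.choose j := by exact_mod_cast Nat.choose_pos h.le
  have hy : (0 : ℝ) < m.choose (j + 1) := by exact_mod_cast Nat.choose_pos h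
  have h₁ : (m.choose (j + 1) : ℝ) * (j + 1) = m.choose j * ((m : ℝ) - j) := by
    have := congrArg (Nat.cast (R := ℝ)) (Nat.choose_succ_right_eq m j)
    push_cast [Nat.cast_sub h.le] at this
    exact this
  unfold betaWeight
  rw [mul_one_div, mul_one_div, div_eq_div_iff (by positivity) (by positivity)]
  linear_combination (-(m : ℝ) - 1) * h₁

theorem betaWeight_mul_choose {m j : ℕ} (h : j ≤ m) :
    ((j : ℝ) + 1) * betaWeight m j * (m + 1).choose (j + 1) = 1 := by
  have hx : (0 : ℝ) < m.choose j := by exact_mod_cast Nat.choose_pos h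
  have h₂ : ((m : ℝ) + 1) * m.choose j = (m + 1).choose (j + 1) * ((j : ℝ) + 1) := by
    exact_mod_cast Nat.add_one_mul_choose_eq m j
  unfold betaWeight
  rw [mul_one_div, div_mul_eq_mul_div, div_eq_one_iff_eq (by positivity)]
  linarith

theorem IsBDSol.sub_mul_increment {n M : ℕ} {g : ℕ → ℝ} (hg : IsBDSol n M g) (hn : 2 ≤ n)
    {j : ℕ} (hj : j < M) :
    ((M : ℝ) - j) * (g j - g (j + 1)) =
      ((n : ℝ) - 1) * M + ((n : ℝ) - 1) * j * (g (j - 1) - g j) := by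
  have hc : (n : ℝ) - 1 ≠ 0 := by
    have : (2 : ℝ) ≤ n := by exact_mod_cast hn
    linarith
  have hM : (M : ℝ) ≠ 0 := by exact_mod_cast (show M ≠ 0 by omega)
  have h := hg.2 j hj
  field_simp at h
  linear_combination h

theorem IsBDSol.increment_eq {n m : ℕ} {g : ℕ → ℝ} (hg : IsBDSol n (m + 1) g) (hn : 2 ≤ n)
    {j : ℕ} (hj : j ≤ m) :
    g j - g (j + 1) = ((n : ℝ) - 1) * (m + 1) *
      (betaWeight m j * binomPartial ((n : ℝ) - 1) (m + 1) j) := by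
  induction j with
  | zero =>
    have h := hg.sub_mul_increment hn (Nat.succ_pos m)
    have hm : (m : ℝ) + 1 ≠ 0 := by positivity
    push_cast at h
    simp only [betaWeight, binomPartial, Nat.choose_zero_right, Nat.cast_one]
    field_simp
    apply mul_left_cancel₀ hm
    linear_combination h
  | succ j ih =>
    have h := hg.sub_mul_increment hn (Nat.lt_succ_of_le hj)
    have hjm : (j : ℝ) < m := by exact_mod_cast hj
    rw [Nat.add_sub_cancel, ih (by omega)] at h
    push_cast at h
    apply mul_left_cancel₀ (sub_pos.mpr hjm).ne'
    rw [binomPartial]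
    linear_combination h - ((n : ℝ) - 1) * (m + 1) * betaWeight_mul_choose (show j ≤ m by omega)
      - ((n : ℝ) - 1) * (m + 1) * ((m + 1).choose (j + 1) +
        ((n : ℝ) - 1) * binomPartial ((n : ℝ) - 1) (m + 1) j) * sub_mul_betaWeight_succ hj

theorem stmt_5 (n M : ℕ) (hn : 2 ≤ n) (hM : 1 ≤ M)
    (g : ℕ → ℝ) (hg : IsBDSol n M g) :
    g 0 = (((n : ℝ) - 1) * M / n) * ∑ k ∈ Finset.Icc 1 M, (n : ℝ) ^ k / k := by
  obtain ⟨m, rfl⟩ := Nat.exists_eq_add_of_le' hM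
  have hn0 : (n : ℝ) ≠ 0 := by exact_mod_cast (show n ≠ 0 by omega)
  have htel := Finset.sum_range_sub' g (m + 1)
  rw [hg.1, sub_zero, Finset.sum_congr rfl fun j hj =>
    hg.increment_eq hn (Nat.lt_succ_iff.mp (Finset.mem_range.mp hj)), ← Finset.mul_sum] at htel
  have hsum := sum_betaWeight_mul_binomPartial ((n : ℝ) - 1) m
  rw [add_sub_cancel] at hsum
  rw [← htel, ← hsum]
  push_cast
  field_simp
end

section
/- Let n ≥ 2 and M ≥ 1 be integers. If g : {0,1,…,M} → ℝ is the birth–death hitting-time solution, then for every 0 ≤ j ≤ M, g(j) = ∑_{k=j}^{M−1} ((n−1)^{k+1}/C(M−1,k)) · ∑_{ℓ=0}^{k} C(M,ℓ)/(n−1)^{ℓ}, where C(n,m) denotes the binomial coefficient (the empty sum for j = M being 0). -/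
/-- The increments `g k - g (k + 1)` of the birth–death hitting-time solution. -/
theorem IsBDSol.sub_succ_eq {n N : ℕ} (hn : 2 ≤ n) {g : ℕ → ℝ} (hg : IsBDSol n (N + 1) g)
    {k : ℕ} (hk : k ≤ N) :
    g k - g (k + 1) = (((n : ℝ) - 1) ^ (k + 1) / (N.choose k : ℝ)) *
      ∑ l ∈ Finset.range (k + 1), ((N + 1).choose l : ℝ) / ((n : ℝ) - 1) ^ l := by
  obtain ⟨m, rfl⟩ : ∃ m, n = m + 2 := ⟨n - 2, by omega⟩
  have hN : (N : ℝ) + 1 ≠ 0 := by positivity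
  have hm : (m : ℝ) + 1 ≠ 0 := by positivity
  have hm' : ((m + 2 : ℕ) : ℝ) - 1 = m + 1 := by push_cast; ring
  have hrec := hg.2 k (by omega)
  rw [hm'] at hrec ⊢
  push_cast at hrec
  induction k with
  | zero =>
    simp only [CharP.cast_eq_zero, zero_div, zero_mul, sub_zero, add_zero] at hrec
    field_simp at hrec
    simp
    linarith
  | succ k ih =>
    have hd := ih (by omega) (by
      have := hg.2 k (by omega)
      rw [hm'] at this
      exact_mod_cast this)
    have hkN : (k : ℝ) + 1 ≤ N := by exact_mod_cast hk
    have hpos : (N : ℝ) - k ≠ 0 := by linarith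
    have hc : (N.choose k : ℝ) ≠ 0 := by
      exact_mod_cast (Nat.choose_pos (by omega : k ≤ N)).ne'
    have hstep : (N.choose (k + 1) : ℝ) * (k + 1) = N.choose k * (N - k) := by
      have := Nat.choose_succ_right_eq N k
      rw [← Nat.cast_sub (by omega : k ≤ N)]
      exact_mod_cast this
    have hpascal : ((N + 1).choose (k + 1) : ℝ) * (k + 1) = (N + 1) * N.choose k := by
      exact_mod_cast (Nat.add_one_mul_choose_eq N k).symm
    have hk1 : (k : ℝ) + 1 ≠ 0 := by positivity
    rw [← eq_div_iff hk1] at hstep hpascal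
    rw [Finset.sum_range_succ, hstep, hpascal]
    set S := ∑ l ∈ Finset.range (k + 1), ((N + 1).choose l : ℝ) / ((m : ℝ) + 1) ^ l
    have hlin : ((N : ℝ) - k) * (g (k + 1) - g (k + 1 + 1)) =
        (m + 1) * ((N + 1) + (k + 1) * (g k - g (k + 1))) := by
      have hm1 : (m : ℝ) + 2 - 1 = m + 1 := by ring
      simp only [Nat.add_sub_cancel] at hrec
      push_cast at hrec
      field_simp at hrec
      linear_combination hrec
    rw [hd] at hlin
    apply mul_left_cancel₀ hpos
    rw [hlin]
    field_simp
    ring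

theorem stmt_6 (n M : ℕ) (hn : 2 ≤ n) (hM : 1 ≤ M)
    (g : ℕ → ℝ) (hg : IsBDSol n M g) :
    ∀ j, j ≤ M →
      g j = ∑ k ∈ Finset.Icc j (M - 1),
        (((n : ℝ) - 1) ^ (k + 1) / ((M - 1).choose k : ℝ)) *
          ∑ ℓ ∈ Finset.range (k + 1), (M.choose ℓ : ℝ) / ((n : ℝ) - 1) ^ ℓ := by
  obtain ⟨N, rfl⟩ : ∃ N, M = N + 1 := ⟨M - 1, by omega⟩
  intro j hj
  rw [Nat.add_sub_cancel,
    ← Finset.sum_congr rfl fun k hk => hg.sub_succ_eq hn (Finset.mem_Icc.1 hk).2,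
    ← Finset.Ico_add_one_right_eq_Icc, ← neg_inj, ← Finset.sum_neg_distrib]
  simp only [neg_sub]
  rw [Finset.sum_Ico_sub g hj, hg.1, zero_sub]
end

section
/- For all integers n ≥ 2 and M ≥ 1, the identity ∑_{k=0}^{M−1} ((n−1)^{k+1}/C(M−1,k)) · ∑_{ℓ=0}^{k} C(M,ℓ)/(n−1)^{ℓ} = ((n−1)M/n) · ∑_{k=1}^{M} n^k/k holds in the real numbers, where C(n,m) denotes the binomial coefficient. -/
/-- The degree-`k` homogenized partial sum of the binomial expansion of `(x + 1) ^ m`. -/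
noncomputable def binomialPartialSum (x : ℝ) (m k : ℕ) : ℝ :=
  ∑ ℓ ∈ Finset.range (k + 1), (m.choose ℓ : ℝ) * x ^ (k - ℓ)

lemma binomialPartialSum_zero (x : ℝ) (m : ℕ) : binomialPartialSum x m 0 = 1 := by
  simp [binomialPartialSum]

lemma binomialPartialSum_self (x : ℝ) (m : ℕ) : binomialPartialSum x m m = (x + 1) ^ m := by
  rw [add_comm x 1, add_pow, binomialPartialSum]
  exact Finset.sum_congr rfl fun ℓ _ => by ring

lemma binomialPartialSum_succ_succ (x : ℝ) (m k : ℕ) :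
    binomialPartialSum x (m + 1) (k + 1) =
      binomialPartialSum x m (k + 1) + binomialPartialSum x m k := by
  unfold binomialPartialSum
  rw [Finset.sum_range_succ', Finset.sum_range_succ' _ (k + 1), add_right_comm,
    ← Finset.sum_add_distrib]
  congr 1
  · refine Finset.sum_congr rfl fun ℓ _ => ?_
    rw [Nat.choose_succ_succ, Nat.add_sub_add_right]
    push_cast
    ring
  · simp

lemma inv_mul_choose_eq_add {m k : ℕ} (hk : k ≤ m) :
    (((m : ℝ) + 1) * m.choose k)⁻¹ =
      (((m : ℝ) + 2) * (m + 1).choose k)⁻¹ + (((m : ℝ) + 2) * (m + 1).choose (k + 1))⁻¹ := by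
  have h0 : (m.choose k : ℝ) ≠ 0 := by exact_mod_cast (Nat.choose_pos hk).ne'
  have h1 : ((m + 1).choose k : ℝ) ≠ 0 := by
    exact_mod_cast (Nat.choose_pos (Nat.le_succ_of_le hk)).ne'
  have h2 : ((m + 1).choose (k + 1) : ℝ) ≠ 0 := by
    exact_mod_cast (Nat.choose_pos (Nat.succ_le_succ hk)).ne'
  have hm1 : (m : ℝ) + 1 ≠ 0 := by positivity
  have hm2 : (m : ℝ) + 2 ≠ 0 := by positivity
  have e1 : ((m : ℝ) + 1) * m.choose k = (m + 1).choose k * ((m : ℝ) + 1 - k) := by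
    have h := Nat.choose_mul_succ_eq m k
    have h' : ((m + 1 - k : ℕ) : ℝ) = (m : ℝ) + 1 - k := by
      rw [Nat.cast_sub (Nat.le_succ_of_le hk)]
      push_cast
      ring
    rw [← h', mul_comm]
    exact_mod_cast h
  have e2 : ((m : ℝ) + 1) * m.choose k = (m + 1).choose (k + 1) * ((k : ℝ) + 1) := by
    exact_mod_cast Nat.add_one_mul_choose_eq m k
  have i1 : ((m + 1).choose k : ℝ)⁻¹ = ((m : ℝ) + 1 - k) / (((m : ℝ) + 1) * m.choose k) := by
    rw [eq_div_iff (mul_ne_zero hm1 h0), e1, inv_mul_cancel_left₀ h1]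
  have i2 : ((m + 1).choose (k + 1) : ℝ)⁻¹ = ((k : ℝ) + 1) / (((m : ℝ) + 1) * m.choose k) := by
    rw [eq_div_iff (mul_ne_zero hm1 h0), e2, inv_mul_cancel_left₀ h2]
  rw [mul_inv ((m : ℝ) + 2), mul_inv ((m : ℝ) + 2), i1, i2]
  field_simp
  ring

lemma sum_inv_mul_choose_mul_binomialPartialSum (x : ℝ) (m : ℕ) :
    ∑ k ∈ Finset.range (m + 1), (((m : ℝ) + 1) * m.choose k)⁻¹ * binomialPartialSum x (m + 1) k =
      ∑ k ∈ Finset.range (m + 1), (x + 1) ^ k / ((k : ℝ) + 1) := by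
  induction m with
  | zero => simp [binomialPartialSum_zero]
  | succ m ih =>
    rw [Finset.sum_range_succ (fun k : ℕ => (x + 1) ^ k / ((k : ℝ) + 1)) (m + 1), ← ih, Finset.sum_range_succ']
    simp_rw [binomialPartialSum_succ_succ x (m + 1)]
    have hsplit : ∑ k ∈ Finset.range (m + 1),
        (((m : ℝ) + 1) * m.choose k)⁻¹ * binomialPartialSum x (m + 1) k =
        ∑ k ∈ Finset.range (m + 1),
          (((m : ℝ) + 2) * (m + 1).choose k)⁻¹ * binomialPartialSum x (m + 1) k +
        ∑ k ∈ Finset.range (m + 1),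
          (((m : ℝ) + 2) * (m + 1).choose (k + 1))⁻¹ * binomialPartialSum x (m + 1) k := by
      rw [← Finset.sum_add_distrib]
      refine Finset.sum_congr rfl fun k hk => ?_
      rw [inv_mul_choose_eq_add (Nat.lt_succ_iff.mp (Finset.mem_range.mp hk)), add_mul]
    have hshift := (Finset.sum_range_succ' (fun k =>
      (((m : ℝ) + 2) * (m + 1).choose k)⁻¹ * binomialPartialSum x (m + 1) k) (m + 1)).symm.trans
      (Finset.sum_range_succ _ (m + 1))
    have hcast : ((m + 1 : ℕ) : ℝ) + 1 = (m : ℝ) + 2 := by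
      push_cast
      ring
    simp only [binomialPartialSum_zero, binomialPartialSum_self, Nat.choose_self, Nat.cast_one,
      mul_one] at hshift
    simp only [hcast, mul_add, Finset.sum_add_distrib, hsplit, binomialPartialSum_zero, mul_one]
    rw [div_eq_inv_mul]
    linear_combination hshift

theorem stmt_7 (n M : ℕ) (hn : 2 ≤ n) (hM : 1 ≤ M) :
    ∑ k ∈ Finset.range M,
        (((n : ℝ) - 1) ^ (k + 1) / ((M - 1).choose k : ℝ)) *
          ∑ ℓ ∈ Finset.range (k + 1), (M.choose ℓ : ℝ) / ((n : ℝ) - 1) ^ ℓ =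
      (((n : ℝ) - 1) * M / n) * ∑ k ∈ Finset.Icc 1 M, (n : ℝ) ^ k / k := by
  obtain ⟨m, rfl⟩ := Nat.exists_eq_add_of_le' hM
  have hn' : (2 : ℝ) ≤ n := by exact_mod_cast hn
  have hn0 : (n : ℝ) ≠ 0 := by positivity
  have hx : (n : ℝ) - 1 ≠ 0 := by linarith
  have hm : (m : ℝ) + 1 ≠ 0 := by positivity
  have key := sum_inv_mul_choose_mul_binomialPartialSum ((n : ℝ) - 1) m
  rw [sub_add_cancel] at key
  have hR : ∑ k ∈ Finset.Icc 1 (m + 1), (n : ℝ) ^ k / k =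
      n * ∑ k ∈ Finset.range (m + 1), (n : ℝ) ^ k / ((k : ℝ) + 1) := by
    rw [← Finset.Ico_add_one_right_eq_Icc, Finset.sum_Ico_eq_sum_range, Finset.mul_sum]
    refine Finset.sum_congr rfl fun k _ => ?_
    push_cast
    rw [pow_add, pow_one, mul_div_assoc, add_comm (1 : ℝ)]
  have hconst : ((n : ℝ) - 1) * (m + 1 : ℕ) / n * n = ((n : ℝ) - 1) * ((m : ℝ) + 1) := by
    push_cast
    field_simp
  rw [hR, ← mul_assoc, hconst, ← key, Finset.mul_sum]
  refine Finset.sum_congr rfl fun k _ => ?_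
  have hP : ((n : ℝ) - 1) ^ k *
      ∑ ℓ ∈ Finset.range (k + 1), ((m + 1).choose ℓ : ℝ) / ((n : ℝ) - 1) ^ ℓ =
      binomialPartialSum ((n : ℝ) - 1) (m + 1) k := by
    rw [binomialPartialSum, Finset.mul_sum]
    refine Finset.sum_congr rfl fun ℓ hℓ => ?_
    rw [pow_sub₀ _ hx (Nat.lt_succ_iff.mp (Finset.mem_range.mp hℓ))]
    ring
  rw [← hP, Nat.add_sub_cancel, mul_inv, pow_succ]
  field_simp
end

section
/- Let n ≥ 2 and M ≥ 1 be integers and let k be an integer with 0 ≤ k ≤ M−1. Then ((n−1)^{k+1}/C(M−1,k)) · ∑_{ℓ=0}^{k} C(M,ℓ)/(n−1)^{ℓ} = (n−1)M · ∫_0^1 x^{M−k−1} (n−(n−1)x)^k dx, where C(n,m) denotes the binomial coefficient. -/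
open intervalIntegral in
theorem integral_pow_mul_affine_pow_succ (a : ℝ) (m k : ℕ) :
    ((m : ℝ) + 1) * ∫ x in (0:ℝ)..1, x ^ m * (1 + a - a * x) ^ (k + 1) =
      1 + a * (k + 1) * ∫ x in (0:ℝ)..1, x ^ (m + 1) * (1 + a - a * x) ^ k := by
  have hderiv : ∀ x : ℝ, HasDerivAt (fun x : ℝ => x ^ (m + 1) * (1 + a - a * x) ^ (k + 1))
      ((m + 1) * (x ^ m * (1 + a - a * x) ^ (k + 1)) -
        a * (k + 1) * (x ^ (m + 1) * (1 + a - a * x) ^ k)) x := by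
    intro x
    have hlin : HasDerivAt (fun x : ℝ => 1 + a - a * x) (-(a * 1)) x :=
      ((hasDerivAt_id x).const_mul a).const_sub (1 + a)
    refine ((hasDerivAt_pow (m + 1) x).fun_mul (hlin.fun_pow (k + 1))).congr_deriv ?_
    simp only [Nat.add_sub_cancel]
    push_cast
    ring
  have hint := integral_eq_sub_of_hasDerivAt (a := 0) (b := 1) (fun x _ => hderiv x)
    (Continuous.intervalIntegrable (by fun_prop) _ _)
  rw [integral_sub (Continuous.intervalIntegrable (by fun_prop) _ _)
    (Continuous.intervalIntegrable (by fun_prop) _ _), integral_const_mul,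
    integral_const_mul] at hint
  norm_num at hint
  linarith

theorem pow_mul_sum_choose_div_pow_eq_integral {a : ℝ} (ha : a ≠ 0) (k m : ℕ) :
    a ^ k * ∑ ℓ ∈ Finset.range (k + 1), ((m + k + 1).choose ℓ : ℝ) / a ^ ℓ =
      (m + k + 1) * ((m + k).choose k : ℝ) *
        ∫ x in (0:ℝ)..1, x ^ m * (1 + a - a * x) ^ k := by
  induction k generalizing m with
  | zero =>
    have : (m : ℝ) + 1 ≠ 0 := by positivity
    simp [this]
  | succ k ih =>
    have hm : (m : ℝ) + 1 ≠ 0 := by positivity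
    have hrec := integral_pow_mul_affine_pow_succ a m k
    have hprev := ih (m + 1)
    have hdown : ((m + (k + 1)).choose (k + 1) : ℝ) * (k + 1) =
        ((m + (k + 1)).choose k : ℝ) * (m + 1) := by
      have h := Nat.choose_succ_right_eq (m + (k + 1)) k
      rw [show m + (k + 1) - k = m + 1 by omega] at h
      exact_mod_cast h
    have hup : ((m + (k + 1)).choose (k + 1) : ℝ) * (m + k + 2) =
        ((m + (k + 1) + 1).choose (k + 1) : ℝ) * (m + 1) := by
      have h := Nat.choose_mul_succ_eq (m + (k + 1)) (k + 1)
      rw [show m + (k + 1) + 1 - (k + 1) = m + 1 by omega] at h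
      have h' := congrArg (Nat.cast (R := ℝ)) h
      push_cast at h'
      linarith
    rw [show m + 1 + k = m + (k + 1) by omega] at hprev
    rw [Finset.sum_range_succ, mul_add, mul_div_cancel₀ _ (pow_ne_zero _ ha), pow_succ',
      mul_assoc, hprev]
    apply mul_left_cancel₀ hm
    push_cast
    linear_combination (-(m + k + 2) * ((m + (k + 1)).choose (k + 1) : ℝ)) * hrec - hup -
      a * (m + k + 2) * (∫ x in (0:ℝ)..1, x ^ (m + 1) * (1 + a - a * x) ^ k) * hdown

theorem stmt_8 (n M k : ℕ) (hn : 2 ≤ n) (hM : 1 ≤ M) (hk : k ≤ M - 1) :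
    (((n : ℝ) - 1) ^ (k + 1) / ((M - 1).choose k : ℝ)) *
        ∑ ℓ ∈ Finset.range (k + 1), (M.choose ℓ : ℝ) / ((n : ℝ) - 1) ^ ℓ =
      ((n : ℝ) - 1) * M *
        ∫ x in (0:ℝ)..1, x ^ (M - k - 1) * ((n : ℝ) - ((n : ℝ) - 1) * x) ^ k := by
  obtain ⟨m, rfl⟩ : ∃ m, M = m + k + 1 := ⟨M - k - 1, by omega⟩
  have ha : (n : ℝ) - 1 ≠ 0 := by
    have : (2 : ℝ) ≤ n := by exact_mod_cast hn
    linarith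
  have hchoose : ((m + k).choose k : ℝ) ≠ 0 := by
    exact_mod_cast (Nat.choose_pos (Nat.le_add_left k m)).ne'
  have h := pow_mul_sum_choose_div_pow_eq_integral ha k m
  rw [add_sub_cancel] at h
  rw [show m + k + 1 - 1 = m + k by omega, show m + k + 1 - k - 1 = m by omega,
    div_mul_eq_mul_div, div_eq_iff hchoose, pow_succ', mul_assoc, h]
  push_cast
  ring
end

section
/- Let n ≥ 2 and M ≥ 1 be integers. Then ∫_0^1 ((1+(n−1)t)^M − (1−t)^M)/t dt = ∑_{k=1}^{M} n^k/k, where the integral is finite (the integrand extends continuously to t = 0). -/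
open MeasureTheory

theorem integral_sub_one_mul_pow_add_pow (a : ℝ) (M : ℕ) :
    (∫ t in (0:ℝ)..1, ((a - 1) * (1 + (a - 1) * t) ^ M + (1 - t) ^ M)) =
      a ^ (M + 1) / ((M + 1 : ℕ) : ℝ) := by
  have hM : ((M + 1 : ℕ) : ℝ) ≠ 0 := by positivity
  have hderiv : ∀ t ∈ Set.uIcc (0:ℝ) 1,
      HasDerivAt (fun t : ℝ => ((1 + (a - 1) * t) ^ (M + 1) - (1 - t) ^ (M + 1)) /
        ((M + 1 : ℕ) : ℝ)) ((a - 1) * (1 + (a - 1) * t) ^ M + (1 - t) ^ M) t := by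
    intro t _
    have hx := (((hasDerivAt_id t).const_mul (a - 1)).const_add 1).pow (M + 1)
    have hy := ((hasDerivAt_id t).const_sub 1).pow (M + 1)
    refine ((hx.sub hy).div_const ((M + 1 : ℕ) : ℝ)).congr_deriv ?_
    simp only [id, Nat.add_sub_cancel]
    field_simp
    ring
  rw [intervalIntegral.integral_eq_sub_of_hasDerivAt hderiv
    (Continuous.intervalIntegrable (by fun_prop) _ _)]
  simp

theorem intervalIntegrable_and_integral_pow_sub_pow_div (a : ℝ) (M : ℕ) :
    IntervalIntegrable (fun t : ℝ => ((1 + (a - 1) * t) ^ M - (1 - t) ^ M) / t) volume 0 1 ∧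
    (∫ t in (0:ℝ)..1, ((1 + (a - 1) * t) ^ M - (1 - t) ^ M) / t) =
      ∑ k ∈ Finset.Icc 1 M, a ^ k / k := by
  induction M with
  | zero => simp
  | succ M ih =>
    obtain ⟨hint, hval⟩ := ih
    have hcont : IntervalIntegrable
        (fun t : ℝ => (a - 1) * (1 + (a - 1) * t) ^ M + (1 - t) ^ M) volume 0 1 :=
      Continuous.intervalIntegrable (by fun_prop) _ _
    have hstep : Set.EqOn
        (fun t : ℝ => ((1 + (a - 1) * t) ^ M - (1 - t) ^ M) / t +
          ((a - 1) * (1 + (a - 1) * t) ^ M + (1 - t) ^ M))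
        (fun t : ℝ => ((1 + (a - 1) * t) ^ (M + 1) - (1 - t) ^ (M + 1)) / t)
        (Set.uIoc 0 1) := by
      intro t ht
      rw [Set.uIoc_of_le zero_le_one] at ht
      have ht0 : t ≠ 0 := ht.1.ne'
      simp only
      field_simp
      ring
    refine ⟨(hint.add hcont).congr hstep, ?_⟩
    rw [← intervalIntegral.integral_congr_ae (Filter.Eventually.of_forall hstep),
      intervalIntegral.integral_add hint hcont, hval, integral_sub_one_mul_pow_add_pow,
      Finset.sum_Icc_succ_top (by omega)]

theorem stmt_11 (n M : ℕ) (hn : 2 ≤ n) (hM : 1 ≤ M) :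
    IntervalIntegrable
        (fun t : ℝ => ((1 + ((n : ℝ) - 1) * t) ^ M - (1 - t) ^ M) / t) volume 0 1 ∧
    (∫ t in (0:ℝ)..1, ((1 + ((n : ℝ) - 1) * t) ^ M - (1 - t) ^ M) / t) =
      ∑ k ∈ Finset.Icc 1 M, (n : ℝ) ^ k / k :=
  intervalIntegrable_and_integral_pow_sub_pow_div n M
end

section
/- Let n ≥ 2 and M ≥ 1 be integers and let s : {1,…,M} → ℝ satisfy s(1) = n−1 and, for every 2 ≤ k ≤ M, s(k) = (k/(k−1))·s(k−1) + (n−1)n^{k−1}. Then s(M) = ((n−1)M/n) · ∑_{k=1}^{M} n^k/k. -/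
theorem stmt_12 (n M : ℕ) (hn : 2 ≤ n) (hM : 1 ≤ M)
    (s : ℕ → ℝ) (hs1 : s 1 = (n : ℝ) - 1)
    (hrec : ∀ k, 2 ≤ k → k ≤ M →
      s k = ((k : ℝ) / ((k : ℝ) - 1)) * s (k - 1) + ((n : ℝ) - 1) * (n : ℝ) ^ (k - 1)) :
    s M = (((n : ℝ) - 1) * M / n) * ∑ k ∈ Finset.Icc 1 M, (n : ℝ) ^ k / k := by
  have hn0 : (n : ℝ) ≠ 0 := by positivity
  induction M, hM using Nat.le_induction with
  | base => simp [hs1, hn0]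
  | succ m hm ih =>
    have hm0 : (m : ℝ) ≠ 0 := by positivity
    have hm1 : (m : ℝ) + 1 ≠ 0 := by positivity
    rw [hrec (m + 1) (by omega) le_rfl, Finset.sum_Icc_succ_top (by omega), Nat.add_sub_cancel,
      ih fun k hk hkm => hrec k hk (by omega)]
    push_cast
    rw [add_sub_cancel_right, pow_succ]
    field_simp
end

section
/- Let n ≥ 2 and k ≥ 2 be integers. If u : {1,…,2k} → ℝ is a harmonic solution for the lumped chain, then u(1) = ((k−1)/k)·u(2k−2). -/
/-- Transition probabilities of the lumped chain on the states `{1,…,2k}`: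
for `1 ≤ i ≤ k`,
`q(2i,2i−1) = 1/k`, `q(2i,2i−2) = (i−1)/k`, `q(2i,2i+2) = (k−i)/(k(n−1))`,
`q(2i,2i) = (k−i)(n−2)/(k(n−1))`, `q(2i−1,2i) = 1/(k(n−1))`,
`q(2i−1,2i+1) = (k−i)/(k(n−1))`, `q(2i−1,2i−3) = (i−1)/k`,
`q(2i−1,2i−1) = (k−i+1)(n−2)/(k(n−1))`, and `q(m,m′) = 0` otherwise. -/
noncomputable def lumpedQ (n k : ℕ) (m m' : ℕ) : ℝ :=
  if m % 2 = 0 then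
    let i := m / 2
    if m' = 2 * i - 1 then 1 / (k : ℝ)
    else if m' = 2 * i - 2 then ((i : ℝ) - 1) / (k : ℝ)
    else if m' = 2 * i + 2 then ((k : ℝ) - (i : ℝ)) / ((k : ℝ) * ((n : ℝ) - 1))
    else if m' = 2 * i then ((k : ℝ) - (i : ℝ)) * ((n : ℝ) - 2) / ((k : ℝ) * ((n : ℝ) - 1))
    else 0
  else
    let i := (m + 1) / 2
    if m' = 2 * i then 1 / ((k : ℝ) * ((n : ℝ) - 1))
    else if m' = 2 * i + 1 then ((k : ℝ) - (i : ℝ)) / ((k : ℝ) * ((n : ℝ) - 1))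
    else if m' = 2 * i - 3 then ((i : ℝ) - 1) / (k : ℝ)
    else if m' = 2 * i - 1 then
      ((k : ℝ) - (i : ℝ) + 1) * ((n : ℝ) - 2) / ((k : ℝ) * ((n : ℝ) - 1))
    else 0

/-- `u` is a harmonic solution for the lumped chain: `u(2k−1) = 0`, `u(2k) = 1`, and
`u(m) = ∑_{m'=1}^{2k} q(m,m')·u(m')` for every `1 ≤ m ≤ 2k−2`; `u(m)` is the probability
of hitting state `2k` before state `2k−1` starting from `m`. -/
def IsHarmonicSol (n k : ℕ) (u : ℕ → ℝ) : Prop :=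
  u (2 * k - 1) = 0 ∧ u (2 * k) = 1 ∧
    ∀ m, 1 ≤ m → m ≤ 2 * k - 2 →
      u m = ∑ m' ∈ Finset.Icc 1 (2 * k), lumpedQ n k m m' * u m'

/-- Harmonicity at an even state, with denominators cleared. -/
lemma IsHarmonicSol.even_eq {n k : ℕ} (hn : 2 ≤ n) {u : ℕ → ℝ}
    (hu : IsHarmonicSol n k u) {j : ℕ} (hj : j + 2 ≤ k) :
    ((n : ℝ) - 1) * (u (2 * j + 2) - u (2 * j + 1))
      + j * ((n : ℝ) - 1) * (u (2 * j + 2) - u (2 * j))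
      + ((k : ℝ) - j - 1) * (u (2 * j + 2) - u (2 * j + 4)) = 0 := by
  have hsum := hu.2.2 (2 * j + 2) (by omega) (by omega)
  have hterm : ∀ m', lumpedQ n k (2 * j + 2) m' * u m' =
      (if m' = 2 * j + 1 then 1 / (k : ℝ) * u (2 * j + 1) else 0)
      + (if m' = 2 * j then (j : ℝ) / k * u (2 * j) else 0)
      + (if m' = 2 * j + 4 then
          ((k : ℝ) - j - 1) / (k * ((n : ℝ) - 1)) * u (2 * j + 4) else 0)
      + (if m' = 2 * j + 2 then
          ((k : ℝ) - j - 1) * ((n : ℝ) - 2) / (k * ((n : ℝ) - 1)) * u (2 * j + 2)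
          else 0) := by
    intro m'
    have hmod : (2 * j + 2) % 2 = 0 := by omega
    have hdiv : (2 * j + 2) / 2 = j + 1 := by omega
    have hdouble : 2 * (j + 1) = 2 * j + 2 := by omega
    simp only [lumpedQ, hmod, hdiv, hdouble, if_true]
    push_cast
    split_ifs <;> first | omega | (subst_vars; ring)
  have hzero : (if 2 * j ∈ Finset.Icc 1 (2 * k) then (j : ℝ) / k * u (2 * j) else 0)
      = (j : ℝ) / k * u (2 * j) := by
    rcases Nat.eq_zero_or_pos j with rfl | hpos
    · simp
    · rw [if_pos (Finset.mem_Icc.2 ⟨by omega, by omega⟩)]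
  simp only [hterm, Finset.sum_add_distrib, Finset.sum_ite_eq'] at hsum
  rw [hzero, if_pos (Finset.mem_Icc.2 ⟨by omega, by omega⟩),
    if_pos (Finset.mem_Icc.2 ⟨by omega, by omega⟩),
    if_pos (Finset.mem_Icc.2 ⟨by omega, by omega⟩)] at hsum
  have hk0 : (k : ℝ) ≠ 0 := by
    have : k ≠ 0 := by omega
    exact_mod_cast this
  have hn0 : (n : ℝ) - 1 ≠ 0 := by
    have : (2 : ℝ) ≤ n := by exact_mod_cast hn
    linarith
  field_simp at hsum
  linear_combination hsum

/-- Harmonicity at an odd state, with denominators cleared. -/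
lemma IsHarmonicSol.odd_eq {n k : ℕ} (hn : 2 ≤ n) {u : ℕ → ℝ}
    (hu : IsHarmonicSol n k u) {j : ℕ} (hj : j + 2 ≤ k) :
    (u (2 * j + 1) - u (2 * j + 2))
      + ((k : ℝ) - j - 1) * (u (2 * j + 1) - u (2 * j + 3))
      + j * ((n : ℝ) - 1) * (u (2 * j + 1) - u (2 * j - 1)) = 0 := by
  have hsum := hu.2.2 (2 * j + 1) (by omega) (by omega)
  have hterm : ∀ m', lumpedQ n k (2 * j + 1) m' * u m' =
      (if m' = 2 * j + 2 then 1 / (k * ((n : ℝ) - 1)) * u (2 * j + 2) else 0)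
      + (if m' = 2 * j + 3 then
          ((k : ℝ) - j - 1) / (k * ((n : ℝ) - 1)) * u (2 * j + 3) else 0)
      + (if m' = 2 * j - 1 then (j : ℝ) / k * u (2 * j - 1) else 0)
      + (if m' = 2 * j + 1 then
          ((k : ℝ) - j) * ((n : ℝ) - 2) / (k * ((n : ℝ) - 1)) * u (2 * j + 1)
          else 0) := by
    intro m'
    have hmod : ¬ (2 * j + 1) % 2 = 0 := by omega
    have hdiv : (2 * j + 1 + 1) / 2 = j + 1 := by omega
    have hdouble : 2 * (j + 1) = 2 * j + 2 := by omega
    simp only [lumpedQ, hmod, hdiv, hdouble, if_false]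
    push_cast
    split_ifs <;> first | omega | (subst_vars; ring)
  have hzero : (if 2 * j - 1 ∈ Finset.Icc 1 (2 * k) then (j : ℝ) / k * u (2 * j - 1) else 0)
      = (j : ℝ) / k * u (2 * j - 1) := by
    rcases Nat.eq_zero_or_pos j with rfl | hpos
    · simp
    · rw [if_pos (Finset.mem_Icc.2 ⟨by omega, by omega⟩)]
  simp only [hterm, Finset.sum_add_distrib, Finset.sum_ite_eq'] at hsum
  rw [hzero, if_pos (Finset.mem_Icc.2 ⟨by omega, by omega⟩),
    if_pos (Finset.mem_Icc.2 ⟨by omega, by omega⟩),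
    if_pos (Finset.mem_Icc.2 ⟨by omega, by omega⟩)] at hsum
  have hk0 : (k : ℝ) ≠ 0 := by
    have : k ≠ 0 := by omega
    exact_mod_cast this
  have hn0 : (n : ℝ) - 1 ≠ 0 := by
    have : (2 : ℝ) ≤ n := by exact_mod_cast hn
    linarith
  field_simp at hsum
  linear_combination hsum

/-- `k` times the average of `u` over the configurations with `r` correct coordinates out of
`k`: the distinguished coordinate is correct in a fraction `r / k` of them. -/
def sphereSum (k : ℕ) (u : ℕ → ℝ) (r : ℕ) : ℝ :=
  ((k : ℝ) - r) * u (2 * r + 1) + r * u (2 * r)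

lemma IsHarmonicSol.sphereSum_succ {n k : ℕ} (hn : 2 ≤ n) {u : ℕ → ℝ}
    (hu : IsHarmonicSol n k u) {r : ℕ} (hr : r + 2 ≤ k) :
    sphereSum k u (r + 1) = sphereSum k u r := by
  induction r with
  | zero =>
    have ho := hu.odd_eq hn hr
    simp only [sphereSum]
    norm_num at ho ⊢
    linear_combination -ho
  | succ r ih =>
    have he := hu.even_eq hn (j := r) (by omega)
    have ho := hu.odd_eq hn hr
    have ih := ih (by omega)
    have hpos : (k : ℝ) - (r + 1) ≠ 0 := by
      have : (r : ℝ) + 1 + 2 ≤ k := by exact_mod_cast hr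
      linarith
    refine mul_left_cancel₀ hpos ?_
    simp only [sphereSum, mul_add, mul_one, add_assoc, Nat.reduceAdd] at he ho ih ⊢
    push_cast at he ho ih ⊢
    linear_combination (r + 1) * ((n : ℝ) - 1) * ih - ((k : ℝ) - (r + 1)) * ho - (r + 1) * he

lemma IsHarmonicSol.sphereSum_eq {n k : ℕ} (hn : 2 ≤ n) {u : ℕ → ℝ}
    (hu : IsHarmonicSol n k u) {r : ℕ} (hr : r + 1 ≤ k) :
    sphereSum k u r = sphereSum k u 0 := by
  induction r with
  | zero => rfl
  | succ r ih => rw [hu.sphereSum_succ hn hr, ih (by omega)]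

theorem stmt_15 (n k : ℕ) (hn : 2 ≤ n) (hk : 2 ≤ k)
    (u : ℕ → ℝ) (hu : IsHarmonicSol n k u) :
    u 1 = (((k : ℝ) - 1) / (k : ℝ)) * u (2 * k - 2) := by
  have hconst := hu.sphereSum_eq hn (r := k - 1) (by omega)
  have h1 : 2 * (k - 1) + 1 = 2 * k - 1 := by omega
  have h2 : 2 * (k - 1) = 2 * k - 2 := by omega
  have hk0 : (k : ℝ) ≠ 0 := by
    have : k ≠ 0 := by omega
    exact_mod_cast this
  simp only [sphereSum, h1, hu.1] at hconst
  rw [h2, Nat.cast_sub (by omega)] at hconst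
  norm_num at hconst
  field_simp
  linear_combination -hconst
end
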